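/- arXiv:1806.06236 — 11 statements merged into one kernel-verified Lean document; each statement's English description precedes it below -/
import Mathlib

section
/- Let U be an ultrafilter on ℕ and let x : ℕ → ℕ. In the reduced power (Germ) semiring *ℕ = ℕ^ℕ/U, the class [x] of x is divisible only by 1 and itself (i.e., [x] ≠ 0, [x] ≠ 1, and for every element y of the reduced power, y ∣ [x] implies y = 1 or y = [x]) if and only if {n ∈ ℕ : x n is prime} ∈ U. -/
theorem Filter.Germ.coe_dvd_coe {α M : Type*} [Semigroup M] {l : Filter α} {f g : α → M} :
    (f : Filter.Germ l M) ∣ (g : Filter.Germ l M) ↔ ∀ᶠ a in l, f a ∣ g a := by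
  classical
  constructor
  · rintro ⟨c, hc⟩
    induction c using Filter.Germ.inductionOn with | _ c
    rw [← Filter.Germ.coe_mul, Filter.Germ.coe_eq] at hc
    filter_upwards [hc] with a ha
    exact ⟨c a, ha⟩
  · intro h
    refine ⟨((fun a => if ha : f a ∣ g a then ha.choose else f a : α → M) : Filter.Germ l M), ?_⟩
    rw [← Filter.Germ.coe_mul, Filter.Germ.coe_eq]
    filter_upwards [h] with a ha
    simpa [ha] using ha.choose_spec

/-- In the reduced power (Germ) semiring `*ℕ = ℕ^ℕ/U`, the class of `x` is
divisible only by `1` and itself iff `x n` is prime for `U`-almost all `n`. -/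
theorem stmt2 (U : Ultrafilter ℕ) (x : ℕ → ℕ) :
    ((x : Filter.Germ (U : Filter ℕ) ℕ) ≠ 0 ∧
     (x : Filter.Germ (U : Filter ℕ) ℕ) ≠ 1 ∧
     ∀ y : Filter.Germ (U : Filter ℕ) ℕ,
       y ∣ (x : Filter.Germ (U : Filter ℕ) ℕ) →
         y = 1 ∨ y = (x : Filter.Germ (U : Filter ℕ) ℕ))
    ↔ {n : ℕ | Nat.Prime (x n)} ∈ U := by
  have eq_one (f : ℕ → ℕ) : (f : Filter.Germ (U : Filter ℕ) ℕ) = 1 ↔ ∀ᶠ n in U, f n = 1 :=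
    Filter.Germ.coe_eq
  have eq_zero (f : ℕ → ℕ) : (f : Filter.Germ (U : Filter ℕ) ℕ) = 0 ↔ ∀ᶠ n in U, f n = 0 :=
    Filter.Germ.coe_eq
  change _ ↔ ∀ᶠ n in U, (x n).Prime
  constructor
  · rintro ⟨-, h1, h⟩
    rw [Ne, eq_one] at h1
    rcases h ((fun n => (x n).minFac : ℕ → ℕ) : Filter.Germ (U : Filter ℕ) ℕ)
      (Filter.Germ.coe_dvd_coe.2 (.of_forall fun n => Nat.minFac_dvd _)) with hy | hy
    · rw [eq_one] at hy
      exact absurd (hy.mono fun n hn => Nat.minFac_eq_one_iff.1 hn) h1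
    · rw [Filter.Germ.coe_eq] at hy
      filter_upwards [hy, Ultrafilter.eventually_not.2 h1] with n hn hn1
      exact hn ▸ Nat.minFac_prime hn1
  · intro hp
    refine ⟨fun h => ?_, fun h => ?_, fun y hy => ?_⟩
    · obtain ⟨n, hn, hn0⟩ := (hp.and ((eq_zero x).1 h)).exists
      exact hn.ne_zero hn0
    · obtain ⟨n, hn, hn1⟩ := (hp.and ((eq_one x).1 h)).exists
      exact hn.ne_one hn1
    · induction y using Filter.Germ.inductionOn with | _ y
      rw [Filter.Germ.coe_dvd_coe] at hy
      rw [eq_one, Filter.Germ.coe_eq, Filter.EventuallyEq, ← Ultrafilter.eventually_or]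
      filter_upwards [hp, hy] with n hn hyn
      exact (Nat.dvd_prime hn).1 hyn
end

section
/- Let U be an ultrafilter on ℕ and let x, y : ℕ → ℕ⁺ be functions into the positive integers such that {n ∈ ℕ : x n ∣ y n} ∈ U. Then v(x) ˜∣ v(y), where v(x) = Ultrafilter.map x U and v(y) = Ultrafilter.map y U. (This is the implication (iii) ⇒ (i) of the main equivalence theorem: if some points of the ultrapower representing F and G satisfy x ∣ y, then F ˜∣ G.) -/
/-- A set of positive integers is upward closed under divisibility. -/
def UpClosed (A : Set ℕ+) : Prop := ∀ a ∈ A, ∀ b : ℕ+, a ∣ b → b ∈ A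

/-- The divisibility relation `F ˜∣ G` on ultrafilters on `ℕ⁺`: every upward
closed set belonging to `F` also belongs to `G`. -/
def UDvd (F G : Ultrafilter ℕ+) : Prop :=
  ∀ A : Set ℕ+, UpClosed A → A ∈ F → A ∈ G

/-- If `x n ∣ y n` for `U`-almost all `n`, then `v(x) ˜∣ v(y)`. -/
theorem stmt5 (U : Ultrafilter ℕ) (x y : ℕ → ℕ+)
    (h : {n : ℕ | x n ∣ y n} ∈ U) :
    UDvd (Ultrafilter.map x U) (Ultrafilter.map y U) := by
  intro A hA hx
  rw [Ultrafilter.mem_map] at hx ⊢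
  filter_upwards [h, hx] with n hn hxn
  exact hA _ hxn _ hn
end

section
/- For any two ultrafilters F, G on the positive integers ℕ⁺, the following are equivalent: (i) F ˜∣ G; (ii) for every A ∈ F and every B ∈ G there exist a ∈ A and b ∈ B with a ∣ b. (This is the combinatorial content of the equivalence theorem connecting ˜∣ with divisibility of representatives in an enlargement: condition (ii) is exactly the concurrency of the relation used to find x, y in the monads of F, G with x ∣ y.) -/
/-- `F ˜∣ G` iff for every `A ∈ F` and every `B ∈ G` there are `a ∈ A` and
`b ∈ B` with `a ∣ b`. -/
theorem stmt6 (F G : Ultrafilter ℕ+) :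
    UDvd F G ↔ ∀ A ∈ F, ∀ B ∈ G, ∃ a ∈ A, ∃ b ∈ B, a ∣ b := by
  constructor
  · intro h A hA B hB
    have hup : UpClosed {b | ∃ a ∈ A, a ∣ b} := by
      rintro b ⟨a, ha, hab⟩ c hbc
      exact ⟨a, ha, hab.trans hbc⟩
    have hmem : {b | ∃ a ∈ A, a ∣ b} ∈ G :=
      h _ hup (Filter.mem_of_superset hA fun a ha => ⟨a, ha, dvd_rfl⟩)
    obtain ⟨b, ⟨a, ha, hab⟩, hb⟩ := G.nonempty_of_mem (Filter.inter_mem hmem hB)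
    exact ⟨a, ha, b, hb, hab⟩
  · intro h A hup hA
    by_contra hAG
    obtain ⟨a, ha, b, hb, hab⟩ := h A hA Aᶜ (Ultrafilter.compl_mem_iff_notMem.2 hAG)
    exact hb (hup a ha b hab)
end

section
/- Let U be a nonprincipal ultrafilter on ℕ and let F be an ultrafilter on the positive integers ℕ⁺. Suppose there exist x, y : ℕ → ℕ⁺ with v(x) = F, v(y) = F, {n ∈ ℕ : x n ≠ y n} ∈ U, and {n ∈ ℕ : x n ∣ y n} ∈ U (i.e., the monad of F contains two distinct ∣-comparable points of the ultrapower). Then no infinite antichain belongs to F, where an antichain is a set A ⊆ ℕ⁺ such that for all distinct a, b ∈ A, a does not divide b. -/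
/-- If the monad of `F` (in the ultrapower over a nonprincipal `U`) contains two
distinct `∣`-comparable points, then no infinite antichain belongs to `F`. -/
theorem stmt8 (U : Ultrafilter ℕ) (hU : ∀ a : ℕ, U ≠ pure a)
    (F : Ultrafilter ℕ+)
    (h : ∃ x y : ℕ → ℕ+, Ultrafilter.map x U = F ∧ Ultrafilter.map y U = F ∧
      {n : ℕ | x n ≠ y n} ∈ U ∧ {n : ℕ | x n ∣ y n} ∈ U) :
    ∀ A : Set ℕ+, A.Infinite → (∀ a ∈ A, ∀ b ∈ A, a ≠ b → ¬ a ∣ b) → A ∉ F := by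
  obtain ⟨x, y, hx, hy, hne, hdvd⟩ := h
  intro A _ hA hAF
  have hxA : x ⁻¹' A ∈ U := Ultrafilter.mem_map.1 (by rwa [hx])
  have hyA : y ⁻¹' A ∈ U := Ultrafilter.mem_map.1 (by rwa [hy])
  obtain ⟨n, ⟨hnx, hny⟩, hn, hnd⟩ := U.nonempty_of_mem
    (Filter.inter_mem (Filter.inter_mem hxA hyA) (Filter.inter_mem hne hdvd))
  exact hA _ hnx _ hny hn hnd
end

section
/- Let U be an ultrafilter on ℕ, let x : ℕ → ℕ, and let P be an ultrafilter on ℕ containing the set of primes. Then the following are equivalent: (i) there exist y, z : ℕ → ℕ with {n : y n is prime} ∈ U, {n : z n is prime} ∈ U, {n : y n ≠ z n} ∈ U, v(y) = P, v(z) = P, and {n : x n = (y n)·(z n)} ∈ U (i.e., x is a product of two distinct primes of *ℕ both having ultrafilter P); (ii) v(x) contains the family F₂^P, i.e., for every A ∈ P consisting of primes, the set A⁽²⁾ = {a·b : a, b ∈ A, a ≠ b} belongs to v(x). -/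
theorem minFac_mul_of_prime {a b : ℕ} (ha : a.Prime) (hb : b.Prime) :
    ((a * b).minFac = a ∧ a * b / (a * b).minFac = b) ∨
      ((a * b).minFac = b ∧ a * b / (a * b).minFac = a) := by
  have hp : (a * b).minFac.Prime :=
    Nat.minFac_prime fun h => ha.one_lt.ne' (Nat.eq_one_of_mul_eq_one_right h)
  rcases hp.dvd_mul.1 (Nat.minFac_dvd (a * b)) with h | h
  · have h := (Nat.prime_dvd_prime_iff_eq hp ha).1 h
    exact Or.inl ⟨h, by rw [h, Nat.mul_div_cancel_left _ ha.pos]⟩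
  · have h := (Nat.prime_dvd_prime_iff_eq hp hb).1 h
    exact Or.inr ⟨h, by rw [h, Nat.mul_div_cancel _ hb.pos]⟩

/-- `x` is a product of two distinct primes of `*ℕ` both having ultrafilter `P`
iff `v(x)` contains the family `F₂^P = {A⁽²⁾ : A ∈ P, A ⊆ primes}`. -/
theorem stmt10 (U : Ultrafilter ℕ) (x : ℕ → ℕ) (P : Ultrafilter ℕ)
    (hP : {p : ℕ | Nat.Prime p} ∈ P) :
    (∃ y z : ℕ → ℕ, {n : ℕ | Nat.Prime (y n)} ∈ U ∧ {n : ℕ | Nat.Prime (z n)} ∈ U ∧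
      {n : ℕ | y n ≠ z n} ∈ U ∧ Ultrafilter.map y U = P ∧ Ultrafilter.map z U = P ∧
      {n : ℕ | x n = y n * z n} ∈ U)
    ↔ (∀ A : Set ℕ, A ⊆ {p : ℕ | Nat.Prime p} → A ∈ P →
        {m : ℕ | ∃ a ∈ A, ∃ b ∈ A, a ≠ b ∧ m = a * b} ∈ Ultrafilter.map x U) := by
  constructor
  · rintro ⟨y, z, -, -, hne, hy, hz, hx⟩ A - hA
    have hyA : y ⁻¹' A ∈ U := Ultrafilter.mem_map.1 (hy ▸ hA)
    have hzA : z ⁻¹' A ∈ U := Ultrafilter.mem_map.1 (hz ▸ hA)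
    rw [Ultrafilter.mem_map]
    filter_upwards [hne, hx, hyA, hzA] with n hne hx hyA hzA
    exact ⟨y n, hyA, z n, hzA, hne, hx⟩
  · intro h
    have key : ∀ A ∈ P, {n | (x n).minFac ∈ A ∧ x n / (x n).minFac ∈ A ∧
        (x n).minFac.Prime ∧ (x n / (x n).minFac).Prime ∧
        (x n).minFac ≠ x n / (x n).minFac} ∈ U := by
      intro A hA
      filter_upwards [Ultrafilter.mem_map.1
        (h (A ∩ {p | p.Prime}) Set.inter_subset_right (Filter.inter_mem hA hP))] with n hn
      obtain ⟨a, ⟨haA, ha⟩, b, ⟨hbA, hb⟩, hab, hx⟩ := hn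
      rw [hx]
      rcases minFac_mul_of_prime ha hb with ⟨h₁, h₂⟩ | ⟨h₁, h₂⟩ <;> rw [h₂, h₁]
      · exact ⟨haA, hbA, ha, hb, hab⟩
      · exact ⟨hbA, haA, hb, ha, hab.symm⟩
    refine ⟨fun n => (x n).minFac, fun n => x n / (x n).minFac, ?_, ?_, ?_, ?_, ?_, ?_⟩
    · filter_upwards [key _ hP] with n hn using hn.2.2.1
    · filter_upwards [key _ hP] with n hn using hn.2.2.2.1
    · filter_upwards [key _ hP] with n hn using hn.2.2.2.2
    · refine Ultrafilter.coe_le_coe.1 fun A hA => ?_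
      change _ ∈ U
      filter_upwards [key A hA] with n hn using hn.1
    · refine Ultrafilter.coe_le_coe.1 fun A hA => ?_
      change _ ∈ U
      filter_upwards [key A hA] with n hn using hn.2.1
    · exact Filter.Eventually.of_forall fun n => (Nat.mul_div_cancel' (Nat.minFac_dvd _)).symm
end

section
/- Let ⟨G_n : n ∈ ℕ⟩ be a ˜∣-increasing sequence of ultrafilters on ℕ⁺ (i.e., G_m ˜∣ G_n whenever m ≤ n) and let F be a nonprincipal ultrafilter on ℕ. Then an upward closed set A ⊆ ℕ⁺ belongs to lim_{n→F} G_n if and only if A belongs to G_n for some n ∈ ℕ; that is, (lim_{n→F} G_n) ∩ 𝒰 = ⋃_{n∈ℕ} (G_n ∩ 𝒰), where 𝒰 is the family of upward closed sets. -/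
/-- The limit `lim_{n→F} G_n`: the ultrafilter `{A : {n : A ∈ G n} ∈ F}`. -/
def ulim (F : Ultrafilter ℕ) (G : ℕ → Ultrafilter ℕ+) : Ultrafilter ℕ+ :=
  F.bind G


/-- For a `˜∣`-increasing sequence `G` and nonprincipal `F`, an upward closed
set belongs to `lim_{n→F} G_n` iff it belongs to some `G n`. -/
theorem stmt11 (G : ℕ → Ultrafilter ℕ+)
    (hG : ∀ m n : ℕ, m ≤ n → UDvd (G m) (G n))
    (F : Ultrafilter ℕ) (hF : ∀ a : ℕ, F ≠ pure a)
    (A : Set ℕ+) (hA : UpClosed A) :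
    A ∈ ulim F G ↔ ∃ n : ℕ, A ∈ G n := by
  change {n | A ∈ G n} ∈ F ↔ _
  constructor
  · exact fun h => F.nonempty_of_mem h
  · rintro ⟨n, hn⟩
    have hle : (F : Filter ℕ) ≤ Filter.atTop := by
      rw [← Nat.cofinite_eq_atTop]
      exact F.le_cofinite_or_eq_pure.resolve_right fun ⟨a, ha⟩ => hF a ha
    exact Filter.mem_of_superset (hle (Filter.mem_atTop n)) fun m hm => hG n m hm A hA hn
end

section
/- Let ⟨G_n : n ∈ ℕ⟩ be a ˜∣-increasing sequence of ultrafilters on ℕ⁺ (i.e., G_m ˜∣ G_n whenever m ≤ n). Then for any two nonprincipal ultrafilters F₁, F₂ on ℕ, lim_{n→F₁} G_n =∼ lim_{n→F₂} G_n, i.e., the two limit ultrafilters divide each other with respect to ˜∣. -/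
/-- The limit of an increasing sequence along any ultrafilter divides its limit along
a nonprincipal one. -/
theorem uDvd_ulim_ulim {G : ℕ → Ultrafilter ℕ+}
    (hG : ∀ m n : ℕ, m ≤ n → UDvd (G m) (G n))
    (F₁ : Ultrafilter ℕ) {F₂ : Ultrafilter ℕ} (h₂ : ∀ a : ℕ, F₂ ≠ pure a) :
    UDvd (ulim F₁ G) (ulim F₂ G) := by
  intro A hA hmem
  have hmem : {n | A ∈ G n} ∈ F₁ := hmem
  obtain ⟨m, hm⟩ := F₁.nonempty_of_mem hmem
  have hF : (F₂ : Filter ℕ) ≤ Filter.atTop := by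
    rw [← Nat.cofinite_eq_atTop]
    exact F₂.le_cofinite_or_eq_pure.resolve_right fun ⟨a, ha⟩ => h₂ a ha
  have hsub : {n | A ∈ G n} ∈ F₂ :=
    hF (Filter.mem_of_superset (Filter.Ici_mem_atTop m) fun n hn => hG m n hn A hA hm)
  exact hsub

/-- For a `˜∣`-increasing sequence `G` and nonprincipal ultrafilters `F₁, F₂`,
the two limits divide each other. -/
theorem stmt12 (G : ℕ → Ultrafilter ℕ+)
    (hG : ∀ m n : ℕ, m ≤ n → UDvd (G m) (G n))
    (F₁ F₂ : Ultrafilter ℕ)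
    (h₁ : ∀ a : ℕ, F₁ ≠ pure a) (h₂ : ∀ a : ℕ, F₂ ≠ pure a) :
    UDvd (ulim F₁ G) (ulim F₂ G) ∧ UDvd (ulim F₂ G) (ulim F₁ G) := by
  exact ⟨uDvd_ulim_ulim hG F₁ h₂, uDvd_ulim_ulim hG F₂ h₁⟩
end

section
/- Let ⟨G_n : n ∈ ℕ⟩ be a ˜∣-increasing sequence of ultrafilters on ℕ⁺ (i.e., G_m ˜∣ G_n whenever m ≤ n), let F be a nonprincipal ultrafilter on ℕ, and let G = lim_{n→F} G_n. If W is an ultrafilter on ℕ⁺ such that G_n ˜∣ W for all n ∈ ℕ, then G ˜∣ W. -/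
/-- If `G` is `˜∣`-increasing, `F` nonprincipal and `G_n ˜∣ W` for all `n`,
then `lim_{n→F} G_n ˜∣ W`. -/
theorem stmt13 (G : ℕ → Ultrafilter ℕ+)
    (hG : ∀ m n : ℕ, m ≤ n → UDvd (G m) (G n))
    (F : Ultrafilter ℕ) (hF : ∀ a : ℕ, F ≠ pure a)
    (W : Ultrafilter ℕ+) (hW : ∀ n : ℕ, UDvd (G n) W) :
    UDvd (ulim F G) W := by
  intro A hA hAG
  have hmem : {n : ℕ | A ∈ G n} ∈ F := hAG
  obtain ⟨n, hn⟩ := F.nonempty_of_mem hmem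
  exact hW n A hA hn
end

section
/- There exists an infinite strictly ˜∣-decreasing sequence of ultrafilters on ℕ⁺: a sequence ⟨G_m : m ∈ ℕ⟩ of ultrafilters on ℕ⁺ such that for all m, G_{m+1} ˜∣ G_m and not G_m ˜∣ G_{m+1}. (Such a sequence is obtained by taking G_m = lim_{n→F} r_m^{m+n} for a nonprincipal ultrafilter F, where r_m^n is the product of the primes p_m, p_{m+1}, …, p_n.) -/
/-- The product of the primes with index in `[m, n)`, where indexing starts at `0`. -/
noncomputable def primeIntervalProd (m n : ℕ) : ℕ+ :=
  ∏ i ∈ Finset.Ico m n, ⟨Nat.nth Nat.Prime i, (Nat.prime_nth_prime i).pos⟩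

lemma coe_primeIntervalProd (m n : ℕ) :
    (primeIntervalProd m n : ℕ) = ∏ i ∈ Finset.Ico m n, Nat.nth Nat.Prime i :=
  map_prod PNat.coeMonoidHom _ _

lemma primeIntervalProd_succ_dvd (m n : ℕ) :
    primeIntervalProd (m + 1) n ∣ primeIntervalProd m n :=
  Finset.prod_dvd_prod_of_subset _ _ _ (Finset.Ico_subset_Ico_left m.le_succ)

lemma nth_prime_dvd_primeIntervalProd_iff {k m n : ℕ} :
    Nat.nth Nat.Prime k ∣ (primeIntervalProd m n : ℕ) ↔ m ≤ k ∧ k < n := by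
  rw [coe_primeIntervalProd, ← Finset.mem_Ico]
  refine ⟨fun h => ?_, Finset.dvd_prod_of_mem _⟩
  obtain ⟨i, hi, hki⟩ := ((Nat.prime_nth_prime k).prime.dvd_finsetProd_iff _).1 h
  rw [Nat.prime_dvd_prime_iff_eq (Nat.prime_nth_prime k) (Nat.prime_nth_prime i)] at hki
  rwa [Nat.nth_injective Nat.infinite_setOfPred_prime hki]

lemma upClosed_setOf_dvd (d : ℕ) : UpClosed {a : ℕ+ | d ∣ (a : ℕ)} :=
  fun _ ha _ hab => ha.trans (PNat.dvd_iff.1 hab)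

lemma uDvd_map_of_forall_dvd {α : Type*} (F : Ultrafilter α) {f g : α → ℕ+}
    (h : ∀ x, f x ∣ g x) : UDvd (F.map f) (F.map g) := fun _ hA hf =>
  Ultrafilter.mem_map.2 <|
    Filter.mem_of_superset (Ultrafilter.mem_map.1 hf) fun x hx => hA _ hx _ (h x)

/-- There is an infinite strictly `˜∣`-decreasing sequence of ultrafilters. -/
theorem stmt14 : ∃ G : ℕ → Ultrafilter ℕ+,
    ∀ m : ℕ, UDvd (G (m + 1)) (G m) ∧ ¬ UDvd (G m) (G (m + 1)) := by
  refine ⟨fun m => (Filter.hyperfilter ℕ).map (primeIntervalProd m), fun m =>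
    ⟨uDvd_map_of_forall_dvd _ (primeIntervalProd_succ_dvd m), fun h => ?_⟩⟩
  have hmem := h _ (upClosed_setOf_dvd (Nat.nth Nat.Prime m)) <| Ultrafilter.mem_map.2 <|
    Filter.mem_of_superset (Nat.hyperfilter_le_atTop (Filter.Ioi_mem_atTop m))
      fun n hn => nth_prime_dvd_primeIntervalProd_iff.2 ⟨le_rfl, hn⟩
  obtain ⟨n, hn⟩ := Ultrafilter.nonempty_of_mem (Ultrafilter.mem_map.1 hmem)
  exact m.not_succ_le_self (nth_prime_dvd_primeIntervalProd_iff.1 hn).1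
end

section
/- Let ⟨G_n : n ∈ ℕ⟩ be a ˜∣-decreasing sequence of ultrafilters on ℕ⁺ (i.e., G_n ˜∣ G_m whenever m ≤ n) and let F be a nonprincipal ultrafilter on ℕ. Then an upward closed set A ⊆ ℕ⁺ belongs to lim_{n→F} G_n if and only if A belongs to G_n for every n ∈ ℕ; that is, (lim_{n→F} G_n) ∩ 𝒰 = ⋂_{n∈ℕ} (G_n ∩ 𝒰), where 𝒰 is the family of upward closed sets. -/
/-- For a `˜∣`-decreasing sequence `G` and nonprincipal `F`, an upward closed
set belongs to `lim_{n→F} G_n` iff it belongs to every `G n`. -/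
theorem stmt15 (G : ℕ → Ultrafilter ℕ+)
    (hG : ∀ m n : ℕ, m ≤ n → UDvd (G n) (G m))
    (F : Ultrafilter ℕ) (hF : ∀ a : ℕ, F ≠ pure a)
    (A : Set ℕ+) (hA : UpClosed A) :
    A ∈ ulim F G ↔ ∀ n : ℕ, A ∈ G n := by
  have mem_iff : A ∈ ulim F G ↔ {n | A ∈ G n} ∈ F := Filter.mem_bind'
  rw [mem_iff]
  refine ⟨fun h n => ?_, fun h => Filter.mem_of_superset Filter.univ_mem fun n _ => h n⟩
  have infinite : {n | A ∈ G n}.Infinite := fun hfin => by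
    obtain ⟨a, -, ha⟩ := Ultrafilter.eq_pure_of_finite_mem hfin h
    exact hF a ha
  obtain ⟨k, hk, hnk⟩ := infinite.exists_gt n
  exact hG n k hnk.le A hA hk
end

section
/- Let F be an ultrafilter on ℕ⁺ that is not in the ˜∣-maximal class, i.e., there exists m ∈ ℕ⁺ such that {k ∈ ℕ⁺ : m ∣ k} ∉ F. Then F has an immediate successor in (βℕ⁺, ˜∣): there exists an ultrafilter G on ℕ⁺ with F ˜∣ G, not G ˜∣ F, and such that for every ultrafilter H with F ˜∣ H and H ˜∣ G, either H =∼ F or H =∼ G. -/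
/-- The upward closure of a set of positive integers under divisibility. -/
def divUpClosure (B : Set ℕ+) : Set ℕ+ := {b | ∃ a ∈ B, a ∣ b}

theorem upClosed_divUpClosure (B : Set ℕ+) : UpClosed (divUpClosure B) := by
  rintro a ⟨c, hc, hca⟩ b hab
  exact ⟨c, hc, hca.trans hab⟩

theorem subset_divUpClosure (B : Set ℕ+) : B ⊆ divUpClosure B :=
  fun b hb => ⟨b, hb, dvd_rfl⟩

/-- An ultrafilter containing the multiples of every prime power contains the multiples of every
positive integer. -/
theorem multiples_mem_of_prime_pow {F : Ultrafilter ℕ+}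
    (hF : ∀ p : ℕ, p.Prime → ∀ e : ℕ, {k : ℕ+ | p ^ e ∣ (k : ℕ)} ∈ F) (m : ℕ) (hm : 0 < m) :
    {k : ℕ+ | m ∣ (k : ℕ)} ∈ F := by
  induction m using Nat.recOnPosPrimePosCoprime with
  | prime_pow p n hp hn => exact hF p hp n
  | zero => exact absurd hm (lt_irrefl 0)
  | one => exact Filter.Eventually.of_forall fun k => by simp
  | coprime a b ha hb hab iha ihb =>
    filter_upwards [iha (by omega), ihb (by omega)] with k hka hkb
    exact hab.mul_dvd_of_dvd_of_dvd hka hkb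

/-- An ultrafilter omitting the multiples of some `m` concentrates on the integers exactly
divisible by some prime power. -/
theorem exists_exact_prime_pow {F : Ultrafilter ℕ+} (h : ∃ m : ℕ+, {k : ℕ+ | m ∣ k} ∉ F) :
    ∃ p e : ℕ, p.Prime ∧ {k : ℕ+ | p ^ e ∣ (k : ℕ)} ∈ F ∧
      {k : ℕ+ | p ^ (e + 1) ∣ (k : ℕ)} ∉ F := by
  by_contra! hcon
  obtain ⟨m, hm⟩ := h
  refine hm ?_
  have hF : ∀ p : ℕ, p.Prime → ∀ e : ℕ, {k : ℕ+ | p ^ e ∣ (k : ℕ)} ∈ F := by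
    intro p hp e
    induction e with
    | zero => exact Filter.Eventually.of_forall fun k => by simp
    | succ e ih => exact hcon p e hp ih
  simpa only [PNat.dvd_iff] using multiples_mem_of_prime_pow hF m m.pos

theorem Nat.Prime.mul_dvd_of_exact_pow {p e k n : ℕ} (hp : p.Prime) (hk : p ^ e ∣ k)
    (hk' : ¬ p ^ (e + 1) ∣ k) (hkn : k ∣ n) (hn : p ^ (e + 1) ∣ n) : p * k ∣ n := by
  obtain ⟨u, rfl⟩ := hk
  obtain ⟨w, rfl⟩ := hkn
  have hpe : 0 < p ^ e := pow_pos hp.pos e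
  rw [pow_succ, mul_assoc, Nat.mul_dvd_mul_iff_left hpe] at hn
  rw [pow_succ, Nat.mul_dvd_mul_iff_left hpe] at hk'
  rw [mul_comm p]
  exact mul_dvd_mul_left _ ((hp.dvd_mul.1 hn).resolve_left hk')

theorem Nat.Prime.dvd_of_dvd_mul_of_exact_pow {p e a k : ℕ} (hp : p.Prime)
    (ha' : ¬ p ^ (e + 1) ∣ a) (ha : p ^ e ∣ a) (hk : p ^ e ∣ k) (hak : a ∣ p * k) : a ∣ k := by
  have hdvd : p * a ∣ p * k :=
    hp.mul_dvd_of_exact_pow ha ha' hak (by rw [pow_succ']; exact mul_dvd_mul_left p hk)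
  exact (Nat.mul_dvd_mul_iff_left hp.pos).1 hdvd

/-- Every ultrafilter on `ℕ⁺` not in the `˜∣`-maximal class has an immediate
`˜∣`-successor. -/
theorem stmt18 (F : Ultrafilter ℕ+)
    (h : ∃ m : ℕ+, {k : ℕ+ | m ∣ k} ∉ F) :
    ∃ G : Ultrafilter ℕ+, UDvd F G ∧ ¬ UDvd G F ∧
      ∀ H : Ultrafilter ℕ+, UDvd F H → UDvd H G →
        (UDvd H F ∧ UDvd F H) ∨ (UDvd H G ∧ UDvd G H) := by
  obtain ⟨p, e, hp, he, he'⟩ := exists_exact_prime_pow h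
  have upClosed_pow (i : ℕ) : UpClosed {k : ℕ+ | p ^ i ∣ (k : ℕ)} :=
    fun a ha b hab => Dvd.dvd.trans ha (PNat.dvd_iff.1 hab)
  let q : ℕ+ := ⟨p, hp.pos⟩
  have coe_q_mul (k : ℕ+) : ((q * k : ℕ+) : ℕ) = p * k := rfl
  refine ⟨F.map (q * ·), ?_, ?_, ?_⟩
  · intro A hA hAF
    rw [Ultrafilter.mem_map]
    filter_upwards [hAF] with k hk
    exact hA k hk _ (dvd_mul_left k q)
  · intro hGF
    refine he' (hGF _ (upClosed_pow (e + 1)) ?_)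
    rw [Ultrafilter.mem_map]
    filter_upwards [he] with k hk
    simpa only [Set.mem_preimage, Set.mem_ofPred_eq, coe_q_mul, pow_succ'] using
      mul_dvd_mul_left p hk
  · intro H hFH hHG
    by_cases hH : {k : ℕ+ | p ^ (e + 1) ∣ (k : ℕ)} ∈ H
    · refine Or.inr ⟨hHG, fun A hA hAG => ?_⟩
      rw [Ultrafilter.mem_map] at hAG
      have hB := Filter.inter_mem (Filter.inter_mem hAG he) (Ultrafilter.compl_mem_iff_notMem.2 he')
      have hBH := hFH _ (upClosed_divUpClosure _) (Filter.mem_of_superset hB (subset_divUpClosure _))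
      filter_upwards [hBH, hH] with n hn hpn
      obtain ⟨k, ⟨⟨hkA, hk⟩, hk'⟩, hkn⟩ := hn
      exact hA _ hkA n (PNat.dvd_iff.2 (hp.mul_dvd_of_exact_pow hk hk' (PNat.dvd_iff.1 hkn) hpn))
    · refine Or.inl ⟨fun A hA hAH => ?_, hFH⟩
      have hB := Filter.inter_mem (Filter.inter_mem hAH (hFH _ (upClosed_pow e) he))
        (Ultrafilter.compl_mem_iff_notMem.2 hH)
      have hBG := hHG _ (upClosed_divUpClosure _) (Filter.mem_of_superset hB (subset_divUpClosure _))
      rw [Ultrafilter.mem_map] at hBG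
      filter_upwards [hBG, he] with k hk hpk
      obtain ⟨a, ⟨⟨haA, ha⟩, ha'⟩, hak⟩ := hk
      exact hA a haA k
        (PNat.dvd_iff.2 (hp.dvd_of_dvd_mul_of_exact_pow ha' ha hpk (PNat.dvd_iff.1 hak)))
end
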